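/- Fix α ∈ ℝ, β > 0 and σ > 0. There exists μ ∈ ℝ such that the set S(α, β, μ, σ) has at least two elements if and only if β·σ·√(2π) < 1. -/

import Mathlib

open Real MeasureTheory

/-- The standard normal cumulative distribution function
`Φ(z) = (1/√(2π)) ∫_{−∞}^{z} exp(−t²/2) dt`. -/
noncomputable def stdNormalCDF (z : ℝ) : ℝ :=
  (Real.sqrt (2 * Real.pi))⁻¹ * ∫ t in Set.Iic z, Real.exp (-t ^ 2 / 2)

/-- The equilibrium solution set `S(α, β, μ, σ) = {θ : α + β·θ = Φ((θ − μ)/σ)}`. -/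
def S (α β μ σ : ℝ) : Set ℝ :=
  {θ : ℝ | α + β * θ = stdNormalCDF ((θ - μ) / σ)}

theorem integrable_exp_neg_sq_div_two : Integrable fun t : ℝ => Real.exp (-t ^ 2 / 2) := by
  refine (integrable_exp_neg_mul_sq (b := 1 / 2) (by norm_num)).congr (.of_forall fun t => ?_)
  dsimp only
  congr 1
  ring

theorem hasDerivAt_stdNormalCDF (z : ℝ) :
    HasDerivAt stdNormalCDF ((√(2 * π))⁻¹ * Real.exp (-z ^ 2 / 2)) z := by
  have hi := integrable_exp_neg_sq_div_two
  have hc : Continuous fun t : ℝ => Real.exp (-t ^ 2 / 2) := by fun_prop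
  have h := ((intervalIntegral.integral_hasDerivAt_right (hi.intervalIntegrable (a := 0) (b := z))
    (hc.stronglyMeasurableAtFilter _ _) hc.continuousAt).const_add
      (∫ t in Set.Iic (0 : ℝ), Real.exp (-t ^ 2 / 2))).const_mul (√(2 * π))⁻¹
  refine h.congr_of_eventuallyEq (.of_forall fun x => ?_)
  have := intervalIntegral.integral_Iic_sub_Iic (hi.integrableOn (s := Set.Iic 0))
    (hi.integrableOn (s := Set.Iic x))
  simp only [stdNormalCDF, ← this]
  ring

theorem stdNormalCDF_nonneg (z : ℝ) : 0 ≤ stdNormalCDF z :=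
  mul_nonneg (by positivity) (integral_nonneg fun _ => (Real.exp_pos _).le)

theorem exists_stdNormalCDF_le : ∃ K, ∀ z, stdNormalCDF z ≤ K :=
  ⟨(√(2 * π))⁻¹ * ∫ t, Real.exp (-t ^ 2 / 2), fun _ =>
    mul_le_mul_of_nonneg_left (setIntegral_le_integral integrable_exp_neg_sq_div_two
      (.of_forall fun _ => (Real.exp_pos _).le)) (by positivity)⟩

theorem hasDerivAt_stdNormalCDF_sub_mul (c z : ℝ) :
    HasDerivAt (fun z => stdNormalCDF z - c * z)
      ((√(2 * π))⁻¹ * Real.exp (-z ^ 2 / 2) - c) z := by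
  simpa using (hasDerivAt_stdNormalCDF z).fun_sub ((hasDerivAt_id' z).const_mul c)

theorem strictAnti_stdNormalCDF_sub_mul {c : ℝ} (hc : (√(2 * π))⁻¹ ≤ c) :
    StrictAnti fun z => stdNormalCDF z - c * z := by
  have hd := hasDerivAt_stdNormalCDF_sub_mul c
  have hcont : Continuous fun z => stdNormalCDF z - c * z :=
    continuous_iff_continuousAt.2 fun z => (hd z).continuousAt
  have hneg : ∀ z ≠ 0, deriv (fun z => stdNormalCDF z - c * z) z < 0 := fun z hz => by
    rw [(hd z).deriv]
    have h1 : Real.exp (-z ^ 2 / 2) < 1 := by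
      rw [Real.exp_lt_one_iff]
      have : 0 < z ^ 2 := by positivity
      linarith
    have h2 : 0 < (√(2 * π))⁻¹ := by positivity
    nlinarith
  refine StrictAntiOn.Iic_union_Ici (a := 0)
    (strictAntiOn_of_deriv_neg (convex_Iic 0) hcont.continuousOn fun z hz => hneg z ?_)
    (strictAntiOn_of_deriv_neg (convex_Ici 0) hcont.continuousOn fun z hz => hneg z ?_)
  · rw [interior_Iic] at hz
    exact ne_of_lt hz
  · rw [interior_Ici] at hz
    exact ne_of_gt hz

theorem not_injective_stdNormalCDF_sub_mul {c : ℝ} (h0 : 0 < c) (hc : c < (√(2 * π))⁻¹) :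
    ¬ Function.Injective fun z => stdNormalCDF z - c * z := by
  intro hinj
  have hd := hasDerivAt_stdNormalCDF_sub_mul c
  have hcont : Continuous fun z => stdNormalCDF z - c * z :=
    continuous_iff_continuousAt.2 fun z => (hd z).continuousAt
  rcases hcont.strictMono_of_inj hinj with hmono | hanti
  · obtain ⟨K, hK⟩ := exists_stdNormalCDF_le
    have hK0 : 0 ≤ K := (stdNormalCDF_nonneg 0).trans (hK 0)
    have h := hmono (show (0 : ℝ) < K / c + 1 by positivity)
    have hz : c * (K / c + 1) = K + c := by field_simp
    simp only [hz] at h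
    linarith [hK (K / c + 1), stdNormalCDF_nonneg 0]
  · have h := hanti.antitone.deriv_nonpos (x := 0)
    rw [(hd 0).deriv] at h
    norm_num at h
    norm_num at hc
    linarith

theorem injective_stdNormalCDF_sub_mul_iff {c : ℝ} (h0 : 0 < c) :
    Function.Injective (fun z => stdNormalCDF z - c * z) ↔ (√(2 * π))⁻¹ ≤ c :=
  ⟨fun h => not_lt.1 fun hc => not_injective_stdNormalCDF_sub_mul h0 hc h,
    fun h => (strictAnti_stdNormalCDF_sub_mul h).injective⟩

/-- There exists an interim belief `μ` for which `S(α, β, μ, σ)` has at least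
two elements if and only if `β·σ·√(2π) < 1` (Proposition 4(i): multiple
equilibria exist for some election results iff polarization is low). -/
theorem stmt5 (α β σ : ℝ) (hβ : 0 < β) (hσ : 0 < σ) :
    (∃ μ : ℝ, ∃ θ₁ ∈ S α β μ σ, ∃ θ₂ ∈ S α β μ σ, θ₁ ≠ θ₂) ↔
      β * σ * Real.sqrt (2 * Real.pi) < 1 := by
  have hlt : β * σ * √(2 * π) < 1 ↔ β * σ < (√(2 * π))⁻¹ := by
    rw [← one_div, lt_div_iff₀ (by positivity)]
  rw [hlt, ← not_le, ← injective_stdNormalCDF_sub_mul_iff (mul_pos hβ hσ),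
    Function.not_injective_iff]
  constructor
  · rintro ⟨μ, θ₁, h₁, θ₂, h₂, hne⟩
    refine ⟨(θ₁ - μ) / σ, (θ₂ - μ) / σ, ?_, fun h => hne ?_⟩
    · simp only [S, Set.mem_ofPred_eq] at h₁ h₂
      rw [← h₁, ← h₂]
      field_simp
      ring
    · field_simp at h
      linarith
  · rintro ⟨x, y, h, hne⟩
    have hmem : ∀ z, stdNormalCDF z - β * σ * z = stdNormalCDF x - β * σ * x →
        (stdNormalCDF x - β * σ * x - α) / β + σ * z ∈
          S α β ((stdNormalCDF x - β * σ * x - α) / β) σ := fun z hz => by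
      rw [S, Set.mem_ofPred_eq, add_sub_cancel_left, mul_div_cancel_left₀ _ hσ.ne', mul_add,
        mul_div_cancel₀ _ hβ.ne']
      linarith
    refine ⟨_, _, hmem x rfl, _, hmem y h.symm, fun h => hne ?_⟩
    exact mul_left_cancel₀ hσ.ne' (add_left_cancel h)
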